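/- arXiv:2102.09901 — 2 statements merged into one kernel-verified Lean document; each statement's English description precedes it below -/
import Mathlib

section
/- The generic 2-dimensional rigidity matroid M_{f_{2,3}}(K_n), the matroid induced by f_{2,3}(F) = 2|V(F)| − 3, is the unique maximal matroid on E(K_n) in which the edge set of every copy of K₄ is a circuit, and its rank function is val_{K₄}. -/
open Set

variable {α : Type*}

/-- `C` is a circuit of `M`: a minimal dependent subset of the ground set. -/
def Matroid.IsCircuit' (M : Matroid α) (C : Set α) : Prop :=
  C ⊆ M.E ∧ ¬ M.Indep C ∧ ∀ e ∈ C, M.Indep (C \ {e})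

/-- `M` is an `X`-matroid on `E`: a matroid with ground set `E` in which every member of the
family `X` is a circuit. -/
def IsXMatroid (E : Set α) (X : Set (Set α)) (M : Matroid α) : Prop :=
  M.E = E ∧ ∀ C ∈ X, M.IsCircuit' C

/-- The union of a list of sets. -/
def unionList (S : List (Set α)) : Set α := ⋃ Y ∈ S, Y

/-- A proper `X`-sequence: a list of members of `X` such that no term is contained in the
union of the preceding terms. -/
def ProperSeq (X : Set (Set α)) (S : List (Set α)) : Prop :=
  (∀ Y ∈ S, Y ∈ X) ∧
  ∀ i : Fin S.length, 0 < i.1 → ¬ (S.get i ⊆ unionList (S.take i.1))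

/-- `val(F, S) = |F ∪ ⋃ S| - |S|`. -/
noncomputable def valSeq (F : Set α) (S : List (Set α)) : ℤ :=
  ((F ∪ unionList S).ncard : ℤ) - S.length

/-- `val_X(F)`: the minimum of `val(F, S)` over all proper `X`-sequences `S`. -/
noncomputable def valX (X : Set (Set α)) (F : Set α) : ℤ :=
  sInf {v : ℤ | ∃ S : List (Set α), ProperSeq X S ∧ v = valSeq F S}

/-- The rank of a set `F` in a matroid `M`: the largest size of an independent subset of `F`. -/
noncomputable def mrk (M : Matroid α) (F : Set α) : ℕ :=
  sSup {n : ℕ | ∃ I ⊆ F, M.Indep I ∧ I.ncard = n}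

/-- The weak order on matroids: `M ⪯ N` iff every independent set of `M` is independent in `N`. -/
def WeakLE (M N : Matroid α) : Prop := ∀ I : Set α, M.Indep I → N.Indep I

/-- The set of vertices incident to a set of edges. -/
def verts {V : Type*} (F : Set (Sym2 V)) : Set V := {v | ∃ e ∈ F, v ∈ e}

/-- The edge sets of matchings with exactly `k` edges in the complete graph `K_n`. -/
def matchingCopies (n k : ℕ) : Set (Set (Sym2 (Fin n))) :=
  {F | F ⊆ (⊤ : SimpleGraph (Fin n)).edgeSet ∧ F.ncard = k ∧
       ∀ e ∈ F, ∀ f ∈ F, e ≠ f → ∀ v : Fin n, v ∈ e → v ∉ f}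
/-- The edge sets of subgraphs of `K_n` isomorphic to a graph `H` on `s` vertices. -/
def graphCopies {s : ℕ} (H : SimpleGraph (Fin s)) (n : ℕ) : Set (Set (Sym2 (Fin n))) :=
  {F | ∃ φ : Fin s ↪ Fin n, F = Sym2.map φ '' H.edgeSet}

namespace K4Rig

open Classical in
/-- Edges of the complete graph on `T`. -/
noncomputable def K {n : ℕ} (T : Finset (Fin n)) : Finset (Sym2 (Fin n)) :=
  T.sym2.filter (fun e => ¬ e.IsDiag)

lemma mem_K {n : ℕ} {T : Finset (Fin n)} {e : Sym2 (Fin n)} :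
    e ∈ K T ↔ (∀ v ∈ e, v ∈ T) ∧ ¬ e.IsDiag := by
  simp [K, Finset.mem_sym2_iff]

lemma mk_mem_K {n : ℕ} {T : Finset (Fin n)} {a b : Fin n} :
    s(a, b) ∈ K T ↔ a ∈ T ∧ b ∈ T ∧ a ≠ b := by
  simp [mem_K, and_assoc]

lemma K_mono {n : ℕ} {T T' : Finset (Fin n)} (h : T ⊆ T') : K T ⊆ K T' := by
  intro e he
  rw [mem_K] at *
  exact ⟨fun v hv => h (he.1 v hv), he.2⟩

lemma card_K {n : ℕ} (T : Finset (Fin n)) : (K T).card = T.card.choose 2 := by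
  rw [← Sym2.card_image_offDiag]
  congr 1
  ext e
  induction e with | _ a b =>
  rw [mk_mem_K]
  simp only [Finset.mem_image, Finset.mem_offDiag, Prod.exists]
  constructor
  · intro h; exact ⟨a, b, h, rfl⟩
  · rintro ⟨c, d, h, he⟩
    rcases Sym2.eq_iff.1 he with ⟨rfl, rfl⟩ | ⟨rfl, rfl⟩
    · exact h
    · exact ⟨h.2.1, h.1, h.2.2.symm⟩

lemma copies_iff {n : ℕ} (Y : Set (Sym2 (Fin n))) :
    Y ∈ graphCopies (⊤ : SimpleGraph (Fin 4)) n ↔ ∃ T : Finset (Fin n), T.card = 4 ∧ Y = ↑(K T) := by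
  have key : ∀ φ : Fin 4 ↪ Fin n,
      Sym2.map φ '' (⊤ : SimpleGraph (Fin 4)).edgeSet = ↑(K (Finset.univ.map φ)) := by
    intro φ
    ext e
    induction e with | _ a b =>
    rw [Finset.mem_coe, mk_mem_K]
    simp only [Finset.mem_map, Finset.mem_univ, true_and, Set.mem_image]
    constructor
    · rintro ⟨f, hf, hfe⟩
      induction f with | _ c d =>
      rw [SimpleGraph.mem_edgeSet, SimpleGraph.top_adj] at hf
      rw [Sym2.map_mk, Sym2.eq_iff] at hfe
      rcases hfe with ⟨rfl, rfl⟩ | ⟨rfl, rfl⟩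
      · exact ⟨⟨c, rfl⟩, ⟨d, rfl⟩, fun h => hf (φ.injective h)⟩
      · exact ⟨⟨d, rfl⟩, ⟨c, rfl⟩, fun h => hf (φ.injective h).symm⟩
    · rintro ⟨⟨c, rfl⟩, ⟨d, rfl⟩, h⟩
      exact ⟨s(c, d), by simpa using fun h' => h (by rw [h']), by simp⟩
  constructor
  · rintro ⟨φ, rfl⟩
    exact ⟨Finset.univ.map φ, by simp, key φ⟩
  · rintro ⟨T, hT, rfl⟩
    refine ⟨(T.orderEmbOfFin hT).toEmbedding, ?_⟩
    rw [key]
    congr 2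
    ext v
    simp only [Finset.mem_map, Finset.mem_univ, true_and]
    have := Finset.range_orderEmbOfFin T hT
    have h2 := Set.ext_iff.1 this v
    simp only [Set.mem_range, Finset.mem_coe] at h2
    exact h2.symm

lemma proper_append {α : Type*} {X : Set (Set α)} {S : List (Set α)} {Y : Set α}
    (hS : ProperSeq X S) (hY : Y ∈ X) (h : ¬ Y ⊆ unionList S) : ProperSeq X (S ++ [Y]) := by
  refine ⟨fun Z hZ => ?_, fun i hi => ?_⟩
  · rcases List.mem_append.1 hZ with h | h
    · exact hS.1 Z h
    · simp at h; exact h ▸ hY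
  · obtain ⟨i, hi'⟩ := i
    simp only [List.length_append, List.length_singleton] at hi'
    simp only [List.get_eq_getElem] at *
    by_cases hlt : i < S.length
    · rw [List.getElem_append_left hlt, List.take_append_of_le_length hlt.le]
      exact hS.2 ⟨i, hlt⟩ hi
    · obtain rfl : i = S.length := by omega
      simpa using h

lemma proper_append_inv {α : Type*} {X : Set (Set α)} {S : List (Set α)} {Y : Set α}
    (hX : ∀ Y ∈ X, Y.Nonempty)
    (hS : ProperSeq X (S ++ [Y])) : ProperSeq X S ∧ Y ∈ X ∧ ¬ Y ⊆ unionList S := by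
  have hY : Y ∈ X := hS.1 Y (by simp)
  refine ⟨⟨fun Z hZ => hS.1 Z (by simp [hZ]), fun i hi => ?_⟩, hY, ?_⟩
  · have := hS.2 ⟨i.1, by have := i.2; simp⟩ hi
    simp only [List.get_eq_getElem] at *
    rwa [List.getElem_append_left i.2, List.take_append_of_le_length i.2.le] at this
  · rcases Nat.eq_zero_or_pos S.length with h0 | h0
    · rw [List.length_eq_zero_iff] at h0
      subst h0
      intro h
      obtain ⟨y, hy⟩ := hX Y hY
      simpa [unionList] using h hy
    · have := hS.2 ⟨S.length, by simp⟩ h0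
      simpa using this

lemma unionList_append {α : Type*} (S : List (Set α)) (Y : Set α) :
    unionList (S ++ [Y]) = unionList S ∪ Y := by
  ext x
  simp only [unionList, Set.mem_iUnion, List.mem_append, List.mem_singleton, Set.mem_union,
    exists_prop]
  constructor
  · rintro ⟨Z, h | rfl, hx⟩
    · exact Or.inl ⟨Z, h, hx⟩
    · exact Or.inr hx
  · rintro (⟨Z, h, hx⟩ | hx)
    · exact ⟨Z, Or.inl h, hx⟩
    · exact ⟨Y, Or.inr rfl, hx⟩

abbrev X4 (n : ℕ) := graphCopies (⊤ : SimpleGraph (Fin 4)) n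

lemma extend_star {n : ℕ} (v a b : Fin n) (hva : v ≠ a) (hvb : v ≠ b) (hab : a ≠ b)
    (R : Finset (Fin n)) : ∀ (S : List (Set (Sym2 (Fin n)))), ProperSeq (X4 n) S →
    (∀ c ∈ R, c ≠ v ∧ c ≠ a ∧ c ≠ b ∧ s(v, c) ∉ unionList S) →
    ∃ S', ProperSeq (X4 n) S' ∧ S'.length = S.length + R.card ∧
      unionList S' ⊆ unionList S ∪ K (insert v (insert a (insert b R))) := by
  induction R using Finset.induction_on with
  | empty => 
    intro S hS _
    exact ⟨S, hS, by simp, Set.subset_union_left⟩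
  | insert c R hc ih =>
    intro S hS h
    obtain ⟨S', hS', hl, hu⟩ := ih S hS (fun d hd => h d (Finset.mem_insert_of_mem hd))
    obtain ⟨h1, h2, h3, h4⟩ := h c (Finset.mem_insert_self _ _)
    refine ⟨S' ++ [↑(K {v, a, b, c})], proper_append hS' ?_ ?_, ?_, ?_⟩
    · rw [copies_iff]
      refine ⟨_, ?_, rfl⟩
      rw [Finset.card_insert_of_notMem, Finset.card_insert_of_notMem, Finset.card_pair] <;> grind
    · intro hsub
      have hm : s(v, c) ∈ unionList S' := by
        apply hsub
        rw [Finset.mem_coe, mk_mem_K]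
        simp [Ne.symm h1]
      rcases hu hm with h | h
      · exact h4 h
      · rw [Finset.mem_coe, mk_mem_K] at h
        simp [*] at h
    · simp [Finset.card_insert_of_notMem hc, hl]; omega
    · rw [unionList_append]
      apply Set.union_subset
      · refine hu.trans (Set.union_subset_union_right _ ?_)
        exact_mod_cast K_mono (by intro x; simp; tauto)
      · refine Set.subset_union_of_subset_right ?_ _
        exact_mod_cast K_mono (by intro x; simp; tauto)

lemma extend_T {n : ℕ} (m : ℕ) : ∀ T : Finset (Fin n), T.card = m + 2 →
    ∀ (S : List (Set (Sym2 (Fin n)))), ProperSeq (X4 n) S →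
    (∀ e ∈ K T, e ∉ unionList S) →
    ∃ S', ProperSeq (X4 n) S' ∧
      (S'.length : ℤ) = S.length + ((K T).card - (2 * T.card - 3)) ∧
      unionList S' ⊆ unionList S ∪ K T := by
  induction m with
  | zero =>
    intro T hT S hS _
    exact ⟨S, hS, by simp [card_K, hT], Set.subset_union_left⟩
  | succ m ih =>
    intro T hT S hS h
    obtain ⟨v, hv⟩ : T.Nonempty := Finset.card_pos.1 (by omega)
    have hT' : (T.erase v).card = m + 2 := by rw [Finset.card_erase_of_mem hv]; omega
    have hKs : K (T.erase v) ⊆ K T := K_mono (Finset.erase_subset _ _)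
    obtain ⟨S1, hS1, hl1, hu1⟩ := ih _ hT' S hS (fun e he => h e (hKs he))
    obtain ⟨a, ha, b, hb, hab⟩ := Finset.one_lt_card.1 (show 1 < (T.erase v).card by omega)
    obtain ⟨S2, hS2, hl2, hu2⟩ := extend_star v a b (Finset.ne_of_mem_erase ha).symm
      (Finset.ne_of_mem_erase hb).symm hab (((T.erase v).erase a).erase b) S1 hS1 (by
        intro c hc
        simp only [Finset.mem_erase] at hc
        refine ⟨hc.2.2.1, hc.2.1, hc.1, fun hm => ?_⟩
        rcases hu1 hm with h' | h'
        · exact h _ (mk_mem_K.2 ⟨hv, hc.2.2.2, hc.2.2.1.symm⟩) h'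
        · rw [Finset.mem_coe, mk_mem_K] at h'
          simp at h')
    refine ⟨S2, hS2, ?_, ?_⟩
    · rw [hl2]
      push_cast
      rw [hl1, Finset.card_erase_of_mem (Finset.mem_erase.2 ⟨hab.symm, hb⟩),
        Finset.card_erase_of_mem ha, hT', card_K, card_K, hT', hT,
        show m + 1 + 2 = (m + 2) + 1 by ring, Nat.choose_succ_succ' (m+2) 1]
      simp
      omega
    · refine hu2.trans (Set.union_subset (hu1.trans (Set.union_subset_union_right _ ?_))
        (Set.subset_union_of_subset_right ?_ _))
      · exact_mod_cast hKs
      · refine Finset.coe_subset.2 (K_mono ?_)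
        intro x hx
        simp only [Finset.mem_insert, Finset.mem_erase] at hx ha hb
        grind

lemma extend_fam {n : ℕ} (𝒯 : Finset (Finset (Fin n))) :
    (∀ T ∈ 𝒯, 2 ≤ T.card) →
    (∀ T ∈ 𝒯, ∀ T' ∈ 𝒯, T ≠ T' → Disjoint (K T) (K T')) →
    ∃ S, ProperSeq (X4 n) S ∧
      (S.length : ℤ) = ∑ T ∈ 𝒯, (((K T).card : ℤ) - (2 * T.card - 3)) ∧
      unionList S ⊆ ↑(𝒯.biUnion K) := by
  induction 𝒯 using Finset.induction_on with
  | empty =>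
    intro _ _
    exact ⟨[], ⟨by simp, fun i => i.elim0⟩, by simp, by simp [unionList]⟩
  | insert T 𝒯 hT ih =>
    intro h2 hd
    obtain ⟨S, hS, hl, hu⟩ := ih (fun T' h' => h2 T' (Finset.mem_insert_of_mem h'))
      (fun T1 h1 T2 h2 => hd T1 (Finset.mem_insert_of_mem h1) T2 (Finset.mem_insert_of_mem h2))
    have h2T := h2 T (Finset.mem_insert_self _ _)
    obtain ⟨S', hS', hl', hu'⟩ := extend_T (T.card - 2) T (by omega) S hS (by
      intro e he heS
      have := hu heS
      rw [Finset.mem_coe, Finset.mem_biUnion] at this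
      obtain ⟨T', hT', heT'⟩ := this
      exact Finset.disjoint_left.1 (hd T (Finset.mem_insert_self _ _) T'
        (Finset.mem_insert_of_mem hT') (by rintro rfl; exact hT hT')) he heT')
    refine ⟨S', hS', ?_, ?_⟩
    · rw [Finset.sum_insert hT, hl', hl]; ring
    · rw [Finset.biUnion_insert, Finset.coe_union, Set.union_comm]
      exact hu'.trans (Set.union_subset_union_left _ hu)

/-- Upper bound: any `X`-matroid has rank at most `val`. -/
lemma exists_span {α : Type*} [Finite α] {X : Set (Set α)} (N : Matroid α)
    (hN : ∀ C ∈ X, N.IsCircuit C) (S : List (Set α)) : ProperSeq X S →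
    ∃ D ⊆ unionList S, D.ncard = S.length ∧ unionList S ⊆ N.closure (unionList S \ D) := by
  induction S using List.reverseRecOn with
  | nil => intro _; exact ⟨∅, by simp, by simp, by simp [unionList]⟩
  | append_singleton S C ih =>
    intro h
    obtain ⟨hS, hC, hsub⟩ := proper_append_inv (fun Y hY => (hN Y hY).nonempty) h
    obtain ⟨D, hDS, hDc, hDs⟩ := ih hS
    obtain ⟨e, heC, heS⟩ := Set.not_subset.1 hsub
    have hcirc := hN C hC
    rw [unionList_append]
    set U := unionList S with hU
    have hUE : U ⊆ N.E := hDs.trans (N.closure_subset_ground _)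
    have hCE := hcirc.subset_ground
    have h1 : U ⊆ N.closure ((U ∪ C) \ insert e D) := by
      refine hDs.trans (N.closure_subset_closure ?_)
      rintro x ⟨hx, hxD⟩
      refine ⟨Or.inl hx, ?_⟩
      rintro (rfl | h)
      · exact heS hx
      · exact hxD h
    have h2 : C \ {e} ⊆ N.closure ((U ∪ C) \ insert e D) := by
      rintro x ⟨hx, hxe⟩
      by_cases hxU : x ∈ U
      · exact h1 hxU
      · refine N.mem_closure_of_mem' ⟨Or.inr hx, ?_⟩ (hCE hx)
        rintro (rfl | h)
        · exact hxe rfl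
        · exact hxU (hDS h)
    refine ⟨insert e D, ?_, ?_, ?_⟩
    · rintro x (rfl | h)
      · exact Or.inr heC
      · exact Or.inl (hDS h)
    · rw [Set.ncard_insert_of_notMem (fun h => heS (hDS h)), hDc]; simp
    · refine Set.union_subset h1 ?_
      have h3 := N.closure_subset_closure_of_subset_closure h2
      exact (hcirc.subset_closure_sdiff_singleton e).trans h3

lemma indep_le_val {α : Type*} [Finite α] {X : Set (Set α)} (N : Matroid α)
    (hN : ∀ C ∈ X, N.IsCircuit C) (S : List (Set α)) (hS : ProperSeq X S)
    (F I : Set α) (hI : N.Indep I) (hIF : I ⊆ F) (hF : F ⊆ N.E) :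
    (I.ncard : ℤ) ≤ valSeq F S := by
  obtain ⟨D, hDS, hDc, hDs⟩ := exists_span N hN S hS
  have hsp : I ⊆ N.closure ((F ∪ unionList S) \ D) := by
    intro x hx
    by_cases hxS : x ∈ unionList S
    · exact N.closure_subset_closure (Set.sdiff_subset_sdiff_left Set.subset_union_right) (hDs hxS)
    · exact N.mem_closure_of_mem' ⟨Or.inl (hIF hx), fun h => hxS (hDS h)⟩ (hF (hIF hx))
  have hle : I.encard ≤ ((F ∪ unionList S) \ D).encard := by
    rw [← hI.eRk_eq_encard]
    refine (N.eRk_mono hsp).trans ?_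
    rw [Matroid.eRk_closure_eq]
    exact N.eRk_le_encard _
  have hle' : I.ncard ≤ ((F ∪ unionList S) \ D).ncard := by
    rw [← (Set.toFinite I).cast_ncard_eq, ← (Set.toFinite _).cast_ncard_eq] at hle
    exact_mod_cast hle
  have hd := Set.ncard_sdiff_add_ncard_of_subset (hDS.trans (Set.subset_union_right (s := F)))
  unfold valSeq
  omega

lemma isCircuit_of {α : Type*} {N : Matroid α} {C : Set α} (h : N.IsCircuit' C) :
    N.IsCircuit C := by
  rw [Matroid.isCircuit_iff_dep_forall_sdiff_singleton_indep]
  exact ⟨⟨h.2.1, h.1⟩, h.2.2⟩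

/-- The independence condition for vertex sets. -/
lemma K_inter_le {n : ℕ} (B : Finset (Sym2 (Fin n)))
    (hB : ∀ I ⊆ (B : Set (Sym2 (Fin n))), I.Nonempty → (I.ncard : ℤ) ≤ 2 * (verts I).ncard - 3)
    (T : Finset (Fin n)) (hT : 2 ≤ T.card) : ((B ∩ K T).card : ℤ) ≤ 2 * T.card - 3 := by
  rcases (B ∩ K T).eq_empty_or_nonempty with h | h
  · rw [h]; simp; omega
  · have := hB ↑(B ∩ K T) (by simp) (by exact_mod_cast h)
    rw [Set.ncard_coe_finset] at this
    have hv : verts (↑(B ∩ K T) : Set (Sym2 (Fin n))) ⊆ T := by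
      rintro v ⟨e, he, hve⟩
      rw [Finset.mem_coe, Finset.mem_inter, mem_K] at he
      exact he.2.1 v hve
    have := Set.ncard_le_ncard hv
    rw [Set.ncard_coe_finset] at this
    omega

def Tight {n : ℕ} (B : Finset (Sym2 (Fin n))) (T : Finset (Fin n)) : Prop :=
  2 ≤ T.card ∧ ((B ∩ K T).card : ℤ) = 2 * T.card - 3

lemma tight_union {n : ℕ} (B : Finset (Sym2 (Fin n)))
    (hB : ∀ I ⊆ (B : Set (Sym2 (Fin n))), I.Nonempty → (I.ncard : ℤ) ≤ 2 * (verts I).ncard - 3)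
    {T T' : Finset (Fin n)} (h : Tight B T) (h' : Tight B T') (hi : 2 ≤ (T ∩ T').card) :
    Tight B (T ∪ T') := by
  have hu : 2 ≤ (T ∪ T').card := h.1.trans (Finset.card_le_card Finset.subset_union_left)
  refine ⟨hu, ?_⟩
  have b1 := K_inter_le B hB _ hi
  have b2 := K_inter_le B hB _ hu
  have c := Finset.card_union_add_card_inter T T'
  have d := Finset.card_union_add_card_inter (B ∩ K T) (B ∩ K T')
  have e1 : (B ∩ K T) ∪ (B ∩ K T') ⊆ B ∩ K (T ∪ T') := by
    rw [← Finset.inter_union_distrib_left]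
    exact Finset.inter_subset_inter_left (Finset.union_subset (K_mono Finset.subset_union_left)
      (K_mono Finset.subset_union_right))
  have e2 : (B ∩ K T) ∩ (B ∩ K T') ⊆ B ∩ K (T ∩ T') := by
    intro e he
    simp only [Finset.mem_inter, mem_K] at *
    exact ⟨he.1.1, fun v hv => ⟨he.1.2.1 v hv, he.2.2.1 v hv⟩, he.1.2.2⟩
  have f1 := Finset.card_le_card e1
  have f2 := Finset.card_le_card e2
  have g := h.2
  have g' := h'.2
  omega

lemma two_le_of_mem_K {n : ℕ} {T : Finset (Fin n)} {e : Sym2 (Fin n)} (h : e ∈ K T) :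
    2 ≤ T.card := by
  induction e with | _ a b =>
  rw [mk_mem_K] at h
  exact Finset.one_lt_card.2 ⟨a, h.1, b, h.2.1, h.2.2⟩

lemma exists_seq {n : ℕ} (F B : Finset (Sym2 (Fin n)))
    (hFE : ∀ e ∈ F, ¬ e.IsDiag) (hBF : B ⊆ F)
    (hB : ∀ I ⊆ (B : Set (Sym2 (Fin n))), I.Nonempty → (I.ncard : ℤ) ≤ 2 * (verts I).ncard - 3)
    (hmax : ∀ e ∈ F, e ∉ B → ∃ I ⊆ (↑(insert e B) : Set (Sym2 (Fin n))), I.Nonempty ∧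
      2 * ((verts I).ncard : ℤ) - 3 < I.ncard) :
    ∃ S, ProperSeq (X4 n) S ∧ valSeq (F : Set (Sym2 (Fin n))) S ≤ B.card := by
  classical
  -- every edge of `F` is in a tight set
  have hcov : ∀ e ∈ F, ∃ T, Tight B T ∧ e ∈ K T := by
    intro e he
    by_cases heB : e ∈ B
    · have hd := hFE e he
      induction e with | _ a b =>
      have hab : a ≠ b := by simpa using hd
      have hK : s(a, b) ∈ K {a, b} := by rw [mk_mem_K]; simp [hab]
      refine ⟨{a, b}, ⟨two_le_of_mem_K hK, ?_⟩, hK⟩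
      have h1 := K_inter_le B hB _ (two_le_of_mem_K hK)
      have h2 : 0 < (B ∩ K {a, b}).card :=
        Finset.card_pos.2 ⟨s(a, b), Finset.mem_inter.2 ⟨heB, hK⟩⟩
      rw [Finset.card_pair hab] at *
      push_cast at *
      omega
    · obtain ⟨I, hI, hIne, hIlt⟩ := hmax e he heB
      have heI : e ∈ I := by
        by_contra h
        have := hB I (fun x hx => by
          have := hI hx
          rw [Finset.mem_coe, Finset.mem_insert] at this
          rcases this with rfl | h'
          · exact absurd hx h
          · exact h') hIne
        omega
      have hIK : ∀ x ∈ I, x ∈ K (verts I).toFinset := by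
        intro x hx
        rw [mem_K]
        refine ⟨fun v hv => by simpa using ⟨x, hx, hv⟩, hFE x ?_⟩
        have := hI hx
        rw [Finset.mem_coe, Finset.mem_insert] at this
        rcases this with rfl | h'
        · exact he
        · exact hBF h'
      have heK := hIK e heI
      refine ⟨(verts I).toFinset, ⟨two_le_of_mem_K heK, ?_⟩, heK⟩
      have h1 := K_inter_le B hB _ (two_le_of_mem_K heK)
      have h2 : I ⊆ ↑(insert e (B ∩ K (verts I).toFinset)) := by
        intro x hx
        have := hI hx
        have := hIK x hx
        simp only [Finset.mem_coe, Finset.mem_insert, Finset.mem_inter] at *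
        tauto
      have h3 := Set.ncard_le_ncard h2
      rw [Set.ncard_coe_finset, Finset.card_insert_of_notMem (by simp [heB])] at h3
      rw [Set.ncard_eq_toFinset_card'] at hIlt
      omega
  set 𝒯 : Finset (Finset (Fin n)) := Finset.univ.filter (fun T => Maximal (Tight B) T) with h𝒯
  have hcov' : ∀ e ∈ F, ∃ T ∈ 𝒯, e ∈ K T := by
    intro e he
    obtain ⟨T, hT, heT⟩ := hcov e he
    obtain ⟨T', hTT', hm⟩ := Set.Finite.exists_le_maximal (Set.toFinite {T | Tight B T}) hT
    exact ⟨T', by simpa [h𝒯] using hm, K_mono hTT' heT⟩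
  have hdis : ∀ T ∈ 𝒯, ∀ T' ∈ 𝒯, T ≠ T' → Disjoint (K T) (K T') := by
    intro T hT T' hT' hne
    have hm : Maximal (Tight B) T := by simpa [h𝒯] using hT
    have hm' : Maximal (Tight B) T' := by simpa [h𝒯] using hT'
    rw [Finset.disjoint_left]
    intro e he he'
    have hi : e ∈ K (T ∩ T') := by
      rw [mem_K] at *
      exact ⟨fun v hv => Finset.mem_inter.2 ⟨he.1 v hv, he'.1 v hv⟩, he.2⟩
    have hu := tight_union B hB hm.prop hm'.prop (two_le_of_mem_K hi)
    exact hne ((hm.eq_of_le hu Finset.subset_union_left).trans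
      (hm'.eq_of_le hu Finset.subset_union_right).symm)
  have htight : ∀ T ∈ 𝒯, Tight B T := by
    intro T hT
    have hm : Maximal (Tight B) T := by simpa [h𝒯] using hT
    exact hm.prop
  obtain ⟨S, hS, hl, hu⟩ := extend_fam 𝒯 (fun T hT => (htight T hT).1) hdis
  refine ⟨S, hS, ?_⟩
  have h1 : (F : Set (Sym2 (Fin n))) ∪ unionList S ⊆ ↑(𝒯.biUnion K) := by
    refine Set.union_subset (fun e he => ?_) hu
    obtain ⟨T, hT, heT⟩ := hcov' e he
    exact Finset.mem_coe.2 (Finset.mem_biUnion.2 ⟨T, hT, heT⟩)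
  have h2 := Set.ncard_le_ncard h1
  rw [Set.ncard_coe_finset] at h2
  have h3 : (𝒯.biUnion K).card ≤ ∑ T ∈ 𝒯, (K T).card := Finset.card_biUnion_le
  have h4 : (𝒯.biUnion (fun T => B ∩ K T)).card = ∑ T ∈ 𝒯, (B ∩ K T).card :=
    Finset.card_biUnion (fun T hT T' hT' hne =>
      (hdis T hT T' hT' hne).mono Finset.inter_subset_right Finset.inter_subset_right)
  have h5 : (𝒯.biUnion (fun T => B ∩ K T)).card ≤ B.card :=
    Finset.card_le_card (Finset.biUnion_subset.2 fun T _ => Finset.inter_subset_left)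
  have h6 : ((∑ T ∈ 𝒯, (B ∩ K T).card : ℕ) : ℤ) = ∑ T ∈ 𝒯, (2 * (T.card : ℤ) - 3) := by
    push_cast
    exact Finset.sum_congr rfl (fun T hT => (htight T hT).2)
  rw [Finset.sum_sub_distrib, ← Nat.cast_sum] at hl
  unfold valSeq
  omega

lemma K4_circuit {n : ℕ} (M : Matroid (Sym2 (Fin n)))
    (hME : M.E = (⊤ : SimpleGraph (Fin n)).edgeSet)
    (hMI : ∀ F : Set (Sym2 (Fin n)), M.Indep F ↔
      F ⊆ (⊤ : SimpleGraph (Fin n)).edgeSet ∧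
      ∀ I ⊆ F, I.Nonempty → (I.ncard : ℤ) ≤ 2 * (verts I).ncard - 3)
    (T : Finset (Fin n)) (hT : T.card = 4) : M.IsCircuit' ↑(K T) := by
  classical
  have hE : (K T : Set (Sym2 (Fin n))) ⊆ (⊤ : SimpleGraph (Fin n)).edgeSet := by
    intro e he
    rw [Finset.mem_coe, mem_K] at he
    simpa using he.2
  have hvT : ∀ I ⊆ (K T : Set (Sym2 (Fin n))), verts I ⊆ T := by
    rintro I hI v ⟨e, he, hve⟩
    exact (mem_K.1 (hI he)).1 v hve
  have hc : (K T).card = 6 := by rw [card_K, hT]; rfl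
  have hvc : ∀ I ⊆ (K T : Set (Sym2 (Fin n))), (verts I).ncard ≤ 4 := by
    intro I hI
    have := Set.ncard_le_ncard (hvT I hI)
    rwa [Set.ncard_coe_finset, hT] at this
  refine ⟨hME ▸ hE, fun h => ?_, fun e he => ?_⟩
  · have := ((hMI _).1 h).2 _ subset_rfl (Finset.coe_nonempty.2 (Finset.card_pos.1 (by omega)))
    have h4 := hvc _ subset_rfl
    rw [Set.ncard_coe_finset] at this
    omega
  · rw [hMI]
    refine ⟨Set.sdiff_subset.trans hE, fun I hI hne => ?_⟩
    have hIK := hI.trans Set.sdiff_subset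
    have hIK' : I ⊆ ↑(K (verts I).toFinset) := by
      intro x hx
      rw [Finset.mem_coe, mem_K]
      exact ⟨fun v hv => by simpa using ⟨x, hx, hv⟩, (mem_K.1 (hIK hx)).2⟩
    have h1 := Set.ncard_le_ncard hIK'
    have h2 := Set.ncard_le_ncard hI
    rw [Set.ncard_sdiff_singleton_of_mem he, Set.ncard_coe_finset, hc] at h2
    obtain ⟨x, hx⟩ := hne
    have h3 := two_le_of_mem_K (hIK' hx)
    rw [Set.ncard_coe_finset, card_K] at h1
    have h4 := hvc I hIK
    rw [Set.ncard_eq_toFinset_card' (verts I)] at h4 ⊢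
    generalize (verts I).toFinset.card = k at *
    interval_cases k <;> simp [Nat.choose] at * <;> omega

lemma exists_basis_seq {n : ℕ} (M : Matroid (Sym2 (Fin n)))
    (hME : M.E = (⊤ : SimpleGraph (Fin n)).edgeSet)
    (hMI : ∀ F : Set (Sym2 (Fin n)), M.Indep F ↔
      F ⊆ (⊤ : SimpleGraph (Fin n)).edgeSet ∧
      ∀ I ⊆ F, I.Nonempty → (I.ncard : ℤ) ≤ 2 * (verts I).ncard - 3)
    (F : Set (Sym2 (Fin n))) (hF : F ⊆ (⊤ : SimpleGraph (Fin n)).edgeSet) :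
    ∃ B ⊆ F, M.Indep B ∧ ∃ S, ProperSeq (X4 n) S ∧ valSeq F S ≤ B.ncard := by
  classical
  obtain ⟨B, hB⟩ := M.exists_isBasis F (hME ▸ hF)
  refine ⟨B, hB.subset, hB.indep, ?_⟩
  obtain ⟨S, hS, hv⟩ := exists_seq F.toFinset B.toFinset
    (fun e he => by
      have := hF (Set.mem_toFinset.1 he)
      simpa using this)
    (by simpa using hB.subset)
    (by rw [Set.coe_toFinset]; exact ((hMI B).1 hB.indep).2)
    (by
      intro e he heB
      rw [Set.mem_toFinset] at he heB
      have hd := hB.insert_dep ⟨he, heB⟩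
      have := hd.not_indep
      rw [hMI] at this
      push Not at this
      have h := this (Set.insert_subset (hF he) (hB.subset.trans hF))
      rw [Finset.coe_insert, Set.coe_toFinset]
      exact h)
  rw [Set.coe_toFinset] at hv
  rw [Set.ncard_eq_toFinset_card']
  exact ⟨S, hS, hv⟩

end K4Rig

theorem rigidityMatroid_unique_maximal_K4 (n : ℕ) (M : Matroid (Sym2 (Fin n)))
    (hME : M.E = (⊤ : SimpleGraph (Fin n)).edgeSet)
    (hMI : ∀ F : Set (Sym2 (Fin n)), M.Indep F ↔
      F ⊆ (⊤ : SimpleGraph (Fin n)).edgeSet ∧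
      ∀ I ⊆ F, I.Nonempty → (I.ncard : ℤ) ≤ 2 * (verts I).ncard - 3) :
    IsXMatroid (⊤ : SimpleGraph (Fin n)).edgeSet
      (graphCopies (⊤ : SimpleGraph (Fin 4)) n) M ∧
    (∀ N : Matroid (Sym2 (Fin n)),
      IsXMatroid (⊤ : SimpleGraph (Fin n)).edgeSet
        (graphCopies (⊤ : SimpleGraph (Fin 4)) n) N → WeakLE N M) ∧
    ∀ F ⊆ (⊤ : SimpleGraph (Fin n)).edgeSet,
      (mrk M F : ℤ) = valX (graphCopies (⊤ : SimpleGraph (Fin 4)) n) F := by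
  have h1 : IsXMatroid (⊤ : SimpleGraph (Fin n)).edgeSet
      (graphCopies (⊤ : SimpleGraph (Fin 4)) n) M := by
    refine ⟨hME, fun C hC => ?_⟩
    obtain ⟨T, hT, rfl⟩ := (K4Rig.copies_iff C).1 hC
    exact K4Rig.K4_circuit M hME hMI T hT
  refine ⟨h1, fun N hN I hI => ?_, fun F hF => ?_⟩
  · have hIE : I ⊆ (⊤ : SimpleGraph (Fin n)).edgeSet := hN.1 ▸ hI.subset_ground
    obtain ⟨B, hBI, hB, S, hS, hv⟩ := K4Rig.exists_basis_seq M hME hMI I hIE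
    have hle := K4Rig.indep_le_val N (fun C hC => K4Rig.isCircuit_of (hN.2 C hC)) S hS I I hI
      subset_rfl hI.subset_ground
    have hEq : B = I := Set.eq_of_subset_of_ncard_le hBI (by omega)
    exact hEq ▸ hB
  · obtain ⟨B, hBF, hB, S, hS, hv⟩ := K4Rig.exists_basis_seq M hME hMI F hF
    have hle : ∀ S, ProperSeq (graphCopies (⊤ : SimpleGraph (Fin 4)) n) S → ∀ I ⊆ F, M.Indep I →
        (I.ncard : ℤ) ≤ valSeq F S := fun S hS I hIF hI =>
      K4Rig.indep_le_val M (fun C hC => K4Rig.isCircuit_of (h1.2 C hC)) S hS F I hI hIF (hME ▸ hF)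
    have hr : mrk M F = B.ncard := by
      refine IsGreatest.csSup_eq ⟨⟨B, hBF, hB, rfl⟩, ?_⟩
      rintro k ⟨I, hIF, hI, rfl⟩
      have := hle S hS I hIF hI
      omega
    have hx : valX (graphCopies (⊤ : SimpleGraph (Fin 4)) n) F = B.ncard := by
      refine IsLeast.csInf_eq ⟨⟨S, hS, le_antisymm (hle S hS B hBF hB) hv⟩, ?_⟩
      rintro k ⟨S', hS', rfl⟩
      exact hle S' hS' B hBF hB
    rw [hr, hx]
end

section
/- The even cycle matroid on E(K_n), with rank function r(F) = |V(F)| − β(F) where β(F) is the number of bipartite connected components of K_n[F], is the unique maximal matroid on E(K_n) in which the edge set of every 4-cycle is a circuit, and its rank function equals val_{C₄}. -/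
open Set

variable {α : Type*}

/-- The edge sets of cycles of length `k` in the complete graph `K_n`. -/
def cycleCopies (n k : ℕ) : Set (Set (Sym2 (Fin n))) :=
  {F | ∃ f : ZMod k ↪ Fin n, F = Set.range fun i : ZMod k => s(f i, f (i + 1))}
/-- The number of bipartite connected components of the graph on `V(F)` with edge set `F`. -/
noncomputable def numBipComps (n : ℕ) (F : Set (Sym2 (Fin n))) : ℕ :=
  Set.ncard {c : (SimpleGraph.fromEdgeSet F).ConnectedComponent |
    (c.supp ∩ verts F).Nonempty ∧
    ∃ g : Fin n → Bool, ∀ u v : Fin n, s(u, v) ∈ F → u ∈ c.supp → g u ≠ g v}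

section Aux

open SimpleGraph

theorem mrk_eq_of_isBasis' {β : Type*} [Finite β] {M : Matroid β} {I X : Set β}
    (h : M.IsBasis' I X) : mrk M X = I.ncard := by
  have hub : ∀ K : Set β, K ⊆ X → M.Indep K → K.ncard ≤ I.ncard := by
    intro K hK hKi
    have h1 : K.encard ≤ I.encard := by
      rw [h.encard_eq_eRk, ← hKi.eRk_eq_encard]
      exact M.eRk_mono hK
    exact ENat.toNat_le_toNat h1 (Set.encard_ne_top_iff.2 I.toFinite)
  unfold mrk
  apply le_antisymm
  · refine csSup_le ⟨_, I, h.subset, h.indep, rfl⟩ ?_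
    rintro _ ⟨K, hK, hKi, rfl⟩
    exact hub K hK hKi
  · refine le_csSup ⟨I.ncard, ?_⟩ ⟨I, h.subset, h.indep, rfl⟩
    rintro _ ⟨K, hK, hKi, rfl⟩
    exact hub K hK hKi

theorem mrk_cast {β : Type*} [Finite β] (M : Matroid β) (X : Set β) :
    (mrk M X : ℕ∞) = M.eRk X := by
  obtain ⟨I, hI⟩ := M.exists_isBasis' X
  rw [mrk_eq_of_isBasis' hI, ← hI.encard_eq_eRk, I.toFinite.cast_ncard_eq]

theorem mrk_mono {β : Type*} [Finite β] (M : Matroid β) {X Y : Set β} (h : X ⊆ Y) :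
    mrk M X ≤ mrk M Y := by
  have := M.eRk_mono h
  rw [← mrk_cast, ← mrk_cast] at this
  exact_mod_cast this

theorem mrk_of_indep {β : Type*} [Finite β] {M : Matroid β} {X : Set β} (h : M.Indep X) :
    mrk M X = X.ncard := mrk_eq_of_isBasis' h.isBasis_self.isBasis'

theorem indep_of_le_mrk {β : Type*} [Finite β] {M : Matroid β} {X : Set β}
    (h : X.ncard ≤ mrk M X) : M.Indep X := by
  obtain ⟨I, hI⟩ := M.exists_isBasis' X
  rw [mrk_eq_of_isBasis' hI] at h
  have := Set.eq_of_subset_of_ncard_le hI.subset h X.toFinite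
  exact this ▸ hI.indep

theorem isBasis_of_mrk_le {β : Type*} [Finite β] {M : Matroid β} {B X : Set β}
    (hB : M.Indep B) (hBX : B ⊆ X) (hX : X ⊆ M.E) (h : mrk M X ≤ B.ncard) : M.IsBasis B X := by
  obtain ⟨J, hJ, hBJ⟩ := hB.subset_isBasis_of_subset hBX hX
  rw [mrk_eq_of_isBasis' hJ.isBasis'] at h
  have := Set.eq_of_subset_of_ncard_le hBJ h J.toFinite
  exact this ▸ hJ

theorem unionList_nil {β : Type*} : unionList ([] : List (Set β)) = ∅ := by
  simp [unionList]

theorem unionList_append_singleton {β : Type*} (S : List (Set β)) (C : Set β) :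
    unionList (S ++ [C]) = unionList S ∪ C := by
  ext x
  simp only [unionList, List.mem_append, List.mem_singleton, Set.mem_iUnion, Set.mem_union,
    exists_prop]
  constructor
  · rintro ⟨Y, h | rfl, hx⟩
    · exact Or.inl ⟨Y, h, hx⟩
    · exact Or.inr hx
  · rintro (⟨Y, h, hx⟩ | hx)
    · exact ⟨Y, Or.inl h, hx⟩
    · exact ⟨C, Or.inr rfl, hx⟩

theorem properSeq_nil {β : Type*} (X : Set (Set β)) : ProperSeq X [] :=
  ⟨by simp, fun i => i.elim0⟩

theorem properSeq_append {β : Type*} {X : Set (Set β)} {S : List (Set β)} {C : Set β}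
    (hS : ProperSeq X S) (hC : C ∈ X) (hn : ¬ C ⊆ unionList S) : ProperSeq X (S ++ [C]) := by
  refine ⟨?_, ?_⟩
  · intro Y hY
    rcases List.mem_append.1 hY with h | h
    · exact hS.1 Y h
    · rw [List.mem_singleton.1 h]; exact hC
  · rintro ⟨i, hi⟩ h0
    simp only [List.length_append, List.length_singleton] at hi
    by_cases h : i < S.length
    · have := hS.2 ⟨i, h⟩ h0
      simpa [List.getElem_append_left h, List.take_append_of_le_length h.le] using this
    · obtain rfl : i = S.length := by omega
      simpa using hn

theorem properSeq_of_append {β : Type*} {X : Set (Set β)} {S : List (Set β)} {C : Set β}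
    (h : ProperSeq X (S ++ [C])) :
    ProperSeq X S ∧ C ∈ X ∧ (S ≠ [] → ¬ C ⊆ unionList S) := by
  refine ⟨⟨fun Y hY => h.1 Y (by simp [hY]), ?_⟩, h.1 C (by simp), ?_⟩
  · rintro ⟨i, hi⟩ h0
    have := h.2 ⟨i, by simp; omega⟩ h0
    simpa [List.getElem_append_left hi, List.take_append_of_le_length hi.le] using this
  · intro hne
    have := h.2 ⟨S.length, by simp⟩ (List.length_pos_iff.2 hne)
    simpa using this

theorem mem_closure_of_isCircuit' {β : Type*} {N : Matroid β} {C : Set β}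
    (hC : N.IsCircuit' C) {e : β} (he : e ∈ C) : e ∈ N.closure (C \ {e}) := by
  rw [(hC.2.2 e he).mem_closure_iff']
  refine ⟨hC.1 he, fun h => ?_⟩
  rw [Set.insert_sdiff_singleton, Set.insert_eq_of_mem he] at h
  exact absurd h hC.2.1

/-- The union of a proper sequence of (nonempty) circuits is spanned by a set that is smaller by
the length of the sequence. -/
theorem exists_span {β : Type*} [Finite β] {N : Matroid β} {X : Set (Set β)}
    (hX : ∀ C ∈ X, N.IsCircuit' C) (hne : ∀ C ∈ X, C.Nonempty) (S : List (Set β)) :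
    ProperSeq X S → ∃ D : Set β, D ⊆ unionList S ∧ D.ncard + S.length ≤ (unionList S).ncard ∧
      unionList S ⊆ N.closure D := by
  induction S using List.reverseRecOn with
  | nil => intro _; exact ⟨∅, by simp, by simp [unionList_nil], by simp [unionList_nil]⟩
  | append_singleton S C ih =>
    intro h
    obtain ⟨hS, hC, hn⟩ := properSeq_of_append h
    obtain ⟨D, hD1, hD2, hD3⟩ := ih hS
    have hn' : ¬ C ⊆ unionList S := by
      by_cases h0 : S = []
      · subst h0
        rw [unionList_nil, Set.subset_empty_iff]
        exact (hne C hC).ne_empty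
      · exact hn h0
    obtain ⟨e, heC, heS⟩ := Set.not_subset.1 hn'
    rw [unionList_append_singleton]
    have hDE : D ⊆ N.E := by
      intro x hx
      obtain ⟨Y, hY, hxY⟩ : ∃ Y ∈ S, x ∈ Y := by simpa [unionList] using hD1 hx
      exact (hX Y (hS.1 Y hY)).1 hxY
    have hCE := (hX C hC).1
    set K : Set β := (C \ unionList S) \ {e} with hK
    have hKC : K ⊆ C := fun x hx => hx.1.1
    refine ⟨D ∪ K, Set.union_subset_union hD1 hKC, ?_, ?_⟩
    · have h1 : (D ∪ K).ncard ≤ D.ncard + K.ncard := Set.ncard_union_le _ _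
      have h2 : K.ncard + 1 = (C \ unionList S).ncard :=
        Set.ncard_sdiff_singleton_add_one ⟨heC, heS⟩ (Set.toFinite _)
      have h3 : (unionList S ∪ C).ncard = (unionList S).ncard + (C \ unionList S).ncard := by
        rw [← Set.union_sdiff_self, Set.ncard_union_eq Set.disjoint_sdiff_right]
      simp only [List.length_append, List.length_singleton]
      omega
    · have h1 : unionList S ⊆ N.closure (D ∪ K) :=
        hD3.trans (N.closure_subset_closure Set.subset_union_left)
      have h2 : C \ {e} ⊆ N.closure (D ∪ K) := by
        intro x hx
        by_cases hxS : x ∈ unionList S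
        · exact h1 hxS
        · exact N.mem_closure_of_mem (Or.inr ⟨⟨hx.1, hxS⟩, hx.2⟩)
            (Set.union_subset hDE (hKC.trans hCE))
      have h3 : e ∈ N.closure (D ∪ K) := by
        have := N.closure_subset_closure h2 (mem_closure_of_isCircuit' (hX C hC) heC)
        rwa [N.closure_closure] at this
      refine Set.union_subset h1 ?_
      intro x hx
      by_cases hxe : x = e
      · rw [hxe]; exact h3
      · exact h2 ⟨hx, hxe⟩

theorem mrk_add_length_le {β : Type*} [Finite β] {N : Matroid β} {X : Set (Set β)}
    (hX : ∀ C ∈ X, N.IsCircuit' C) (hne : ∀ C ∈ X, C.Nonempty) (S : List (Set β))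
    (hS : ProperSeq X S) (F : Set β) (hF : F ⊆ N.E) :
    mrk N (F ∪ unionList S) + S.length ≤ (F ∪ unionList S).ncard := by
  obtain ⟨D, hD1, hD2, hD3⟩ := exists_span hX hne S hS
  have h1 : F ∪ unionList S ⊆ N.closure (D ∪ (F \ unionList S)) := by
    have h0 : unionList S ⊆ N.closure (D ∪ (F \ unionList S)) :=
      hD3.trans (N.closure_subset_closure Set.subset_union_left)
    refine Set.union_subset ?_ h0
    intro x hx
    by_cases hxS : x ∈ unionList S
    · exact h0 hxS
    · exact N.mem_closure_of_mem' (Or.inr ⟨hx, hxS⟩) (hF hx)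
  have h2 : mrk N (F ∪ unionList S) ≤ (D ∪ (F \ unionList S)).ncard := by
    have := (N.eRk_mono h1).trans ((N.eRk_closure_eq _).le.trans (N.eRk_le_encard _))
    rw [← mrk_cast, ← (Set.toFinite (D ∪ (F \ unionList S))).cast_ncard_eq] at this
    exact_mod_cast this
  have h3 : (D ∪ (F \ unionList S)).ncard ≤ D.ncard + (F \ unionList S).ncard :=
    Set.ncard_union_le _ _
  have h4 : (F ∪ unionList S).ncard = (unionList S).ncard + (F \ unionList S).ncard := by
    rw [Set.union_comm, ← Set.union_sdiff_self, Set.ncard_union_eq Set.disjoint_sdiff_right]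
  omega

/-! ### Forests -/

theorem acyclic_card {V : Type*} [Finite V] (k : ℕ) : ∀ G : SimpleGraph V, G.IsAcyclic →
    G.edgeSet.ncard = k → G.edgeSet.ncard + Nat.card G.ConnectedComponent ≤ Nat.card V := by
  induction k with
  | zero =>
    intro G _ h
    rw [h, zero_add]
    exact Nat.card_le_card_of_surjective G.connectedComponentMk Quot.mk_surjective
  | succ k ih =>
    intro G hG h
    obtain ⟨e, he⟩ : G.edgeSet.Nonempty := by
      apply Set.nonempty_of_ncard_ne_zero; omega
    induction e using Sym2.ind with
    | _ u v =>
    have hle : G.deleteEdges {s(u, v)} ≤ G := G.deleteEdges_le _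
    have hcard : (G.deleteEdges {s(u, v)}).edgeSet.ncard = k := by
      rw [edgeSet_deleteEdges]
      have := Set.ncard_sdiff_singleton_add_one he (Set.toFinite _)
      omega
    have h1 := ih _ (hG.anti hle) hcard
    have hb : G.IsBridge s(u, v) := isAcyclic_iff_forall_isBridge.1 hG he
    have hnr : ¬ (G.deleteEdges {s(u, v)}).Reachable u v := by
      have := (isBridge_iff.1 hb)
      simpa using this
    have h2 : Nat.card G.ConnectedComponent <
        Nat.card (G.deleteEdges {s(u, v)}).ConnectedComponent := by
      have hs : Function.Surjective
          (ConnectedComponent.map (SimpleGraph.Hom.ofLE hle)) := by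
        intro c
        induction c using ConnectedComponent.ind with
        | _ w => exact ⟨(G.deleteEdges {s(u, v)}).connectedComponentMk w, rfl⟩
      refine lt_of_le_of_ne (Nat.card_le_card_of_surjective _ hs) ?_
      intro heq
      have hinj := ((Nat.bijective_iff_surjective_and_card
        (ConnectedComponent.map (SimpleGraph.Hom.ofLE hle))).2 ⟨hs, heq.symm⟩).1
      apply hnr
      rw [← ConnectedComponent.eq]
      apply hinj
      exact ConnectedComponent.eq.2 (Adj.reachable he)
    omega

theorem ncard_add_numBipComps_le (n : ℕ) (G : SimpleGraph (Fin n)) (hG : G.IsAcyclic) :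
    G.edgeSet.ncard + numBipComps n G.edgeSet ≤ (verts G.edgeSet).ncard := by
  have h1 := acyclic_card _ G hG rfl
  rw [Nat.card_fin] at h1
  unfold numBipComps
  rw [SimpleGraph.fromEdgeSet_edgeSet]
  set A : Set G.ConnectedComponent := {c | (c.supp ∩ verts G.edgeSet).Nonempty ∧
    ∃ g : Fin n → Bool, ∀ u v : Fin n, s(u, v) ∈ G.edgeSet → u ∈ c.supp → g u ≠ g v} with hA
  have h2 : (verts G.edgeSet)ᶜ.ncard ≤ Aᶜ.ncard := by
    have hiso : ∀ v ∈ (verts G.edgeSet)ᶜ, ∀ w, G.Reachable v w → v = w := by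
      intro v hv w ⟨p⟩
      cases p with
      | nil => rfl
      | cons h p => exact absurd ⟨s(v, _), h, Sym2.mem_mk_left _ _⟩ hv
    refine Set.ncard_le_ncard_of_injOn G.connectedComponentMk ?_ ?_ (Set.toFinite _)
    · rintro v hv ⟨⟨w, hw, hw'⟩, -⟩
      have := hiso v hv w (ConnectedComponent.eq.1 hw).symm
      exact hv (this ▸ hw')
    · intro v hv w _ h
      exact hiso v hv w (ConnectedComponent.eq.1 h)
  have h3 := Set.ncard_add_ncard_compl A
  have h4 := Set.ncard_add_ncard_compl (verts G.edgeSet)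
  rw [Nat.card_fin] at h4
  omega


/-! ### Sets of edges closed under completing 4-cycles -/

theorem dist_le_two_of_closed {n : ℕ} {J : Set (Sym2 (Fin n))}
    (hJ : ∀ x y z w, s(x, y) ∈ J → s(y, z) ∈ J → s(z, w) ∈ J → x ≠ w → s(x, w) ∈ J)
    {u w : Fin n} (h : (fromEdgeSet J).Reachable u w) :
    u = w ∨ s(u, w) ∈ J ∨ ∃ z, s(u, z) ∈ J ∧ s(z, w) ∈ J := by
  rw [reachable_iff_reflTransGen] at h
  induction h with
  | refl => exact Or.inl rfl
  | @tail b c _ hbc ih =>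
    have hbc' : s(b, c) ∈ J := ((fromEdgeSet_adj J).1 hbc).1
    rcases ih with rfl | h | ⟨z, h1, h2⟩
    · exact Or.inr (Or.inl hbc')
    · exact Or.inr (Or.inr ⟨b, h, hbc'⟩)
    · by_cases huc : u = c
      · exact Or.inl huc
      · exact Or.inr (Or.inl (hJ _ _ _ _ h1 h2 hbc' huc))

theorem numBipComps_lt {n : ℕ} {J : Set (Sym2 (Fin n))}
    (hJ : ∀ x y z w, s(x, y) ∈ J → s(y, z) ∈ J → s(z, w) ∈ J → x ≠ w → s(x, w) ∈ J)
    {u v : Fin n} (huv : u ≠ v) (huvJ : s(u, v) ∉ J) (h : (fromEdgeSet J).Reachable u v) :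
    numBipComps n (insert s(u, v) J) < numBipComps n J ∧
      verts (insert s(u, v) J) = verts J := by
  obtain ⟨z, huz, hzv⟩ : ∃ z, s(u, z) ∈ J ∧ s(z, v) ∈ J := by
    rcases dist_le_two_of_closed hJ h with h | h | h
    · exact absurd h huv
    · exact absurd h huvJ
    · exact h
  have hsymm : ∀ {a b}, s(a, b) ∈ J → s(b, a) ∈ J := fun {a b} h => by rwa [Sym2.eq_swap]
  have hverts : verts (insert s(u, v) J) = verts J := by
    ext x
    constructor
    · rintro ⟨e, rfl | he, hx⟩
      · rcases Sym2.mem_iff.1 hx with rfl | rfl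
        · exact ⟨_, huz, Sym2.mem_mk_left _ _⟩
        · exact ⟨_, hzv, Sym2.mem_mk_right _ _⟩
      · exact ⟨e, he, hx⟩
    · rintro ⟨e, he, hx⟩
      exact ⟨e, Or.inr he, hx⟩
  refine ⟨?_, hverts⟩
  have hle : fromEdgeSet J ≤ fromEdgeSet (insert s(u, v) J) :=
    fromEdgeSet_mono (Set.subset_insert _ _)
  unfold numBipComps
  rw [hverts]
  set A : Set (fromEdgeSet J).ConnectedComponent := {c | (c.supp ∩ verts J).Nonempty ∧
    ∃ g : Fin n → Bool, ∀ u v : Fin n, s(u, v) ∈ J → u ∈ c.supp → g u ≠ g v} with hA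
  have hu : (fromEdgeSet J).connectedComponentMk u ∈ A := by
    refine ⟨⟨u, rfl, _, huz, Sym2.mem_mk_left _ _⟩, ?_⟩
    classical
    refine ⟨fun w => decide (s(u, w) ∈ J), ?_⟩
    intro w w' hww hw hg
    have hw2 : (fromEdgeSet J).Reachable u w := (ConnectedComponent.eq.1 hw).symm
    have hg' : s(u, w) ∈ J ↔ s(u, w') ∈ J := by simpa using hg
    by_cases hc : s(u, w) ∈ J
    · have hc' := hg'.1 hc
      by_cases hz : w' = z
      · subst hz
        exact huvJ (hJ _ _ _ _ hc hww hzv huv)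
      · have h1 : s(w', z) ∈ J := hJ _ _ _ _ (hsymm hww) (hsymm hc) huz hz
        exact huvJ (hJ _ _ _ _ hc' h1 hzv huv)
    · have hc' : s(u, w') ∉ J := fun h => hc (hg'.2 h)
      rcases dist_le_two_of_closed hJ hw2 with rfl | h | ⟨p, h1, h2⟩
      · exact hc' hww
      · exact hc h
      · by_cases huw : u = w'
        · subst huw
          exact hc (hsymm hww)
        · exact hc' (hJ _ _ _ _ h1 h2 hww huw)
  have hsub : {c : (fromEdgeSet (insert s(u, v) J)).ConnectedComponent |
      (c.supp ∩ verts J).Nonempty ∧ ∃ g : Fin n → Bool, ∀ a b : Fin n,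
        s(a, b) ∈ insert s(u, v) J → a ∈ c.supp → g a ≠ g b} ⊆
      (ConnectedComponent.map (Hom.ofLE hle)) ''
        (A \ {(fromEdgeSet J).connectedComponentMk u}) := by
    rintro c ⟨⟨w, hwc, hwv⟩, g, hg⟩
    have hc : (fromEdgeSet (insert s(u, v) J)).connectedComponentMk w = c := hwc
    subst hc
    have hlift : ∀ x, (fromEdgeSet J).Reachable x w →
        x ∈ ((fromEdgeSet (insert s(u, v) J)).connectedComponentMk w).supp :=
      fun x hx => ConnectedComponent.eq.2 (hx.mono hle)
    refine ⟨(fromEdgeSet J).connectedComponentMk w, ⟨⟨⟨w, rfl, hwv⟩, g, ?_⟩, ?_⟩, rfl⟩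
    · intro a b hab ha
      exact hg a b (Or.inr hab) (hlift a (ConnectedComponent.eq.1 ha))
    · intro hwu
      have hwu' : (fromEdgeSet J).Reachable w u := ConnectedComponent.eq.1 hwu
      have hadj : (fromEdgeSet J).Adj u z := by
        rw [fromEdgeSet_adj]
        refine ⟨huz, ?_⟩
        rintro rfl
        exact huvJ hzv
      have g1 := hg u v (Or.inl rfl) (hlift u hwu'.symm)
      have g2 := hg u z (Or.inr huz) (hlift u hwu'.symm)
      have g3 := hg z v (Or.inr hzv) (hlift z (hwu'.trans hadj.reachable).symm)
      revert g1 g2 g3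
      cases g u <;> cases g v <;> cases g z <;> simp
  calc _ ≤ _ := Set.ncard_le_ncard hsub (Set.toFinite _)
    _ ≤ _ := Set.ncard_image_le (Set.toFinite _)
    _ < A.ncard := Set.ncard_sdiff_singleton_lt_of_mem hu (Set.toFinite _)

/-! ### 4-cycles -/

theorem mem_cycleCopies_four {n : ℕ} {x y z w : Fin n} (hxy : x ≠ y) (hxz : x ≠ z) (hxw : x ≠ w)
    (hyz : y ≠ z) (hyw : y ≠ w) (hzw : z ≠ w) :
    ({s(x, y), s(y, z), s(z, w), s(w, x)} : Set (Sym2 (Fin n))) ∈ cycleCopies n 4 := by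
  let f : Fin 4 → Fin n := ![x, y, z, w]
  have hf : Function.Injective f := by
    intro i j
    fin_cases i <;> fin_cases j <;> simp [f, *, Ne.symm, eq_comm]
  refine ⟨⟨f, hf⟩, ?_⟩
  ext e
  simp only [Set.mem_insert_iff, Set.mem_singleton_iff, Set.mem_range]
  constructor
  · rintro (rfl | rfl | rfl | rfl)
    · exact ⟨(0 : Fin 4), rfl⟩
    · exact ⟨(1 : Fin 4), rfl⟩
    · exact ⟨(2 : Fin 4), rfl⟩
    · exact ⟨(3 : Fin 4), rfl⟩
  · rintro ⟨i, rfl⟩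
    change Fin 4 at i
    fin_cases i
    · exact Or.inl rfl
    · exact Or.inr (Or.inl rfl)
    · exact Or.inr (Or.inr (Or.inl rfl))
    · exact Or.inr (Or.inr (Or.inr rfl))

/-- A 4-cycle, based at any of its edges. -/
theorem exists_of_mem_cycleCopies_four {n : ℕ} {C : Set (Sym2 (Fin n))}
    (hC : C ∈ cycleCopies n 4) : C.Nonempty ∧ ∀ e ∈ C, ∃ x y z w : Fin n, x ≠ y ∧ x ≠ z ∧ x ≠ w ∧
      y ≠ z ∧ y ≠ w ∧ z ≠ w ∧ e = s(w, x) ∧ C = {s(x, y), s(y, z), s(z, w), s(w, x)} := by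
  obtain ⟨f, rfl⟩ := hC
  refine ⟨Set.range_nonempty _, ?_⟩
  rintro _ ⟨i, rfl⟩
  have hne : ∀ a b : ZMod 4, a ≠ b → f a ≠ f b := fun a b h => f.injective.ne h
  refine ⟨f (i + 1), f (i + 2), f (i + 3), f i, hne _ _ ?_, hne _ _ ?_, hne _ _ ?_, hne _ _ ?_,
    hne _ _ ?_, hne _ _ ?_, rfl, ?_⟩
  · revert i; decide
  · revert i; decide
  · revert i; decide
  · revert i; decide
  · revert i; decide
  · revert i; decide
  · have e1 : i + 1 + 1 = i + 2 := by revert i; decide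
    have e2 : i + 2 + 1 = i + 3 := by revert i; decide
    have e3 : i + 3 + 1 = i := by revert i; decide
    ext e
    simp only [Set.mem_insert_iff, Set.mem_singleton_iff, Set.mem_range]
    constructor
    · rintro ⟨j, rfl⟩
      have hj : j = i + 1 ∨ j = i + 2 ∨ j = i + 3 ∨ j = i := by revert i j; decide
      rcases hj with rfl | rfl | rfl | rfl
      · rw [e1]; simp
      · rw [e2]; simp
      · rw [e3]; simp
      · simp
    · rintro (rfl | rfl | rfl | rfl)
      · exact ⟨i + 1, by rw [e1]⟩
      · exact ⟨i + 2, by rw [e2]⟩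
      · exact ⟨i + 3, by rw [e3]⟩
      · exact ⟨i, rfl⟩

theorem isCircuit'_four {n : ℕ} {M : Matroid (Sym2 (Fin n))}
    (hME : M.E = (⊤ : SimpleGraph (Fin n)).edgeSet)
    (hMr : ∀ F ⊆ (⊤ : SimpleGraph (Fin n)).edgeSet,
      (mrk M F : ℤ) = (verts F).ncard - numBipComps n F)
    {C : Set (Sym2 (Fin n))} (hC : C ∈ cycleCopies n 4) : M.IsCircuit' C := by
  obtain ⟨⟨e₀, he₀⟩, hall⟩ := exists_of_mem_cycleCopies_four hC
  have hCE : C ⊆ (⊤ : SimpleGraph (Fin n)).edgeSet := by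
    obtain ⟨x, y, z, w, hxy, hxz, hxw, hyz, hyw, hzw, -, rfl⟩ := hall e₀ he₀
    rintro e (rfl | rfl | rfl | rfl) <;> simp [hxy, hyz, hzw, hxw.symm]
  refine ⟨hME ▸ hCE, ?_, ?_⟩
  · intro hI
    have h1 := hMr C hCE
    rw [mrk_of_indep hI] at h1
    obtain ⟨x, y, z, w, hxy, hxz, hxw, hyz, hyw, hzw, -, rfl⟩ := hall e₀ he₀
    have hcard : ({s(x, y), s(y, z), s(z, w), s(w, x)} : Set (Sym2 (Fin n))).ncard = 4 := by
      rw [Set.ncard_insert_of_notMem, Set.ncard_insert_of_notMem, Set.ncard_insert_of_notMem,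
        Set.ncard_singleton] <;> simp <;> grind
    have hverts : (verts ({s(x, y), s(y, z), s(z, w), s(w, x)} : Set (Sym2 (Fin n)))).ncard ≤ 4 := by
      have : verts ({s(x, y), s(y, z), s(z, w), s(w, x)} : Set (Sym2 (Fin n))) ⊆
          ((({x, y, z, w} : Finset (Fin n))) : Set (Fin n)) := by
        rintro a ⟨e, (rfl | rfl | rfl | rfl), ha⟩ <;> rcases Sym2.mem_iff.1 ha with rfl | rfl <;>
          simp
      refine (Set.ncard_le_ncard this (Set.toFinite _)).trans ?_
      rw [Set.ncard_coe_finset]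
      exact Finset.card_le_four
    have hb : 0 < numBipComps n {s(x, y), s(y, z), s(z, w), s(w, x)} := by
      unfold numBipComps
      rw [Set.ncard_pos (Set.toFinite _)]
      refine ⟨connectedComponentMk _ x, ⟨x, rfl, s(x, y), by simp, by simp⟩, ?_⟩
      refine ⟨fun a => decide (a = x ∨ a = z), ?_⟩
      intro a b hab _
      simp only [Set.mem_insert_iff, Set.mem_singleton_iff, Sym2.eq_iff] at hab
      grind
    omega
  · intro e he
    obtain ⟨x, y, z, w, hxy, hxz, hxw, hyz, hyw, hzw, rfl, rfl⟩ := hall e he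
    have hP : ({s(x, y), s(y, z), s(z, w), s(w, x)} : Set (Sym2 (Fin n))) \ {s(w, x)} =
        {s(x, y), s(y, z), s(z, w)} := by
      ext e
      simp only [Set.mem_sdiff, Set.mem_insert_iff, Set.mem_singleton_iff]
      constructor
      · tauto
      · intro h
        refine ⟨by tauto, ?_⟩
        rintro rfl
        simp only [Sym2.eq_iff] at h
        grind
    rw [hP]
    have hPE : ({s(x, y), s(y, z), s(z, w)} : Set (Sym2 (Fin n))) ⊆
        (⊤ : SimpleGraph (Fin n)).edgeSet := by
      rintro e (rfl | rfl | rfl) <;> simp [hxy, hyz, hzw]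
    have h1 := hMr _ hPE
    have hcard : ({s(x, y), s(y, z), s(z, w)} : Set (Sym2 (Fin n))).ncard ≤ 3 := by
      refine (Set.ncard_insert_le _ _).trans ?_
      have := Set.ncard_insert_le s(y, z) ({s(z, w)} : Set (Sym2 (Fin n)))
      rw [Set.ncard_singleton] at this
      omega
    have hverts : 4 ≤ (verts ({s(x, y), s(y, z), s(z, w)} : Set (Sym2 (Fin n)))).ncard := by
      have h4 : ({x, y, z, w} : Set (Fin n)).ncard = 4 := by
        rw [Set.ncard_insert_of_notMem, Set.ncard_insert_of_notMem, Set.ncard_insert_of_notMem,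
          Set.ncard_singleton] <;> simp <;> grind
      rw [← h4]
      refine Set.ncard_le_ncard ?_ (Set.toFinite _)
      rintro a (rfl | rfl | rfl | rfl)
      · exact ⟨s(a, y), by simp, by simp⟩
      · exact ⟨s(x, a), by simp, by simp⟩
      · exact ⟨s(y, a), by simp, by simp⟩
      · exact ⟨s(z, a), by simp, by simp⟩
    have hb : numBipComps n {s(x, y), s(y, z), s(z, w)} ≤ 1 := by
      unfold numBipComps
      set G := fromEdgeSet ({s(x, y), s(y, z), s(z, w)} : Set (Sym2 (Fin n))) with hG
      have a1 : G.Adj x y := by simp [hG, hxy]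
      have a2 : G.Adj y z := by simp [hG, hyz]
      have a3 : G.Adj z w := by simp [hG, hzw]
      have hr : ∀ a ∈ verts ({s(x, y), s(y, z), s(z, w)} : Set (Sym2 (Fin n))),
          G.connectedComponentMk a = G.connectedComponentMk y := by
        have c1 : G.connectedComponentMk x = G.connectedComponentMk y :=
          ConnectedComponent.eq.2 a1.reachable
        have c2 : G.connectedComponentMk z = G.connectedComponentMk y :=
          ConnectedComponent.eq.2 a2.symm.reachable
        have c3 : G.connectedComponentMk w = G.connectedComponentMk y :=
          ConnectedComponent.eq.2 (a3.symm.reachable.trans a2.symm.reachable)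
        rintro a ⟨e, (rfl | rfl | rfl), ha⟩ <;> rcases Sym2.mem_iff.1 ha with rfl | rfl <;>
          first | assumption | rfl
      rw [Set.ncard_le_one (Set.toFinite _)]
      rintro c ⟨⟨a, ha, ha'⟩, -⟩ d ⟨⟨b, hb, hb'⟩, -⟩
      rw [← (show G.connectedComponentMk a = c from ha), ← (show G.connectedComponentMk b = d from hb),
        hr a ha', hr b hb']
    apply indep_of_le_mrk
    omega

/-- Greedily complete 4-cycles, starting from `B`. -/
theorem exists_closed_seq {n : ℕ} (B : Set (Sym2 (Fin n)))
    (hB : B ⊆ (⊤ : SimpleGraph (Fin n)).edgeSet) :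
    ∃ S : List (Set (Sym2 (Fin n))), ProperSeq (cycleCopies n 4) S ∧
      (B ∪ unionList S).ncard ≤ B.ncard + S.length ∧
      B ∪ unionList S ⊆ (⊤ : SimpleGraph (Fin n)).edgeSet ∧
      ∀ x y z w, s(x, y) ∈ B ∪ unionList S → s(y, z) ∈ B ∪ unionList S →
        s(z, w) ∈ B ∪ unionList S → x ≠ w → s(x, w) ∈ B ∪ unionList S := by
  by_contra hcon
  push Not at hcon
  have key : ∀ k : ℕ, ∃ S : List (Set (Sym2 (Fin n))), ProperSeq (cycleCopies n 4) S ∧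
      (B ∪ unionList S).ncard ≤ B.ncard + S.length ∧
      B ∪ unionList S ⊆ (⊤ : SimpleGraph (Fin n)).edgeSet ∧ k ≤ (B ∪ unionList S).ncard := by
    intro k
    induction k with
    | zero => exact ⟨[], properSeq_nil _, by simp [unionList_nil], by simpa [unionList_nil] using hB,
        Nat.zero_le _⟩
    | succ k ih =>
      obtain ⟨S, h1, h2, h3, h4⟩ := ih
      obtain ⟨x, y, z, w, hxy, hyz, hzw, hxw, hn⟩ := hcon S h1 h2 h3
      set J := B ∪ unionList S with hJ
      have nxy : x ≠ y := by simpa using h3 hxy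
      have nyz : y ≠ z := by simpa using h3 hyz
      have nzw : z ≠ w := by simpa using h3 hzw
      have nxz : x ≠ z := by rintro rfl; exact hn hzw
      have nyw : y ≠ w := by rintro rfl; exact hn hxy
      have hC := mem_cycleCopies_four nxy nxz hxw nyz nyw nzw
      have hsw : s(w, x) = s(x, w) := Sym2.eq_swap
      have hJ' : B ∪ unionList (S ++ [{s(x, y), s(y, z), s(z, w), s(w, x)}]) =
          insert s(x, w) J := by
        rw [unionList_append_singleton, ← Set.union_assoc, ← hJ, hsw]
        ext e
        simp only [Set.mem_union, Set.mem_insert_iff, Set.mem_singleton_iff]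
        constructor
        · rintro (h | rfl | rfl | rfl | rfl)
          · exact Or.inr h
          · exact Or.inr hxy
          · exact Or.inr hyz
          · exact Or.inr hzw
          · exact Or.inl rfl
        · rintro (rfl | h)
          · simp
          · exact Or.inl h
      refine ⟨S ++ [{s(x, y), s(y, z), s(z, w), s(w, x)}], properSeq_append h1 hC ?_, ?_, ?_, ?_⟩
      · intro hsub
        apply hn
        right
        apply hsub
        simp [hsw]
      · rw [hJ', Set.ncard_insert_of_notMem hn (Set.toFinite _)]
        simp only [List.length_append, List.length_singleton]
        omega
      · rw [hJ']
        rintro e (rfl | he)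
        · simpa using hxw
        · exact h3 he
      · rw [hJ', Set.ncard_insert_of_notMem hn (Set.toFinite _)]
        omega
  obtain ⟨S, -, -, -, h⟩ := key (Nat.card (Sym2 (Fin n)) + 1)
  have := Set.ncard_le_card (B ∪ unionList S)
  omega

theorem exists_seq_le_mrk {n : ℕ} {M : Matroid (Sym2 (Fin n))}
    (hME : M.E = (⊤ : SimpleGraph (Fin n)).edgeSet)
    (hMr : ∀ F ⊆ (⊤ : SimpleGraph (Fin n)).edgeSet,
      (mrk M F : ℤ) = (verts F).ncard - numBipComps n F)
    (F : Set (Sym2 (Fin n))) (hF : F ⊆ (⊤ : SimpleGraph (Fin n)).edgeSet) :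
    ∃ S, ProperSeq (cycleCopies n 4) S ∧ valSeq F S ≤ mrk M F := by
  have hcirc : ∀ C ∈ cycleCopies n 4, M.IsCircuit' C := fun C hC => isCircuit'_four hME hMr hC
  have hne : ∀ C ∈ cycleCopies n 4, C.Nonempty :=
    fun C hC => (exists_of_mem_cycleCopies_four hC).1
  obtain ⟨T, hTF, hTa, hTr⟩ := (fromEdgeSet F).exists_isAcyclic_reachable_eq_le
  have hTE : T.edgeSet ⊆ (⊤ : SimpleGraph (Fin n)).edgeSet := edgeSet_mono le_top
  have hTsub : T.edgeSet ⊆ F := by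
    intro e he
    have := edgeSet_mono hTF he
    rw [edgeSet_fromEdgeSet] at this
    exact this.1
  have hTi : M.Indep T.edgeSet := by
    apply indep_of_le_mrk
    have h1 := hMr _ hTE
    have h2 := ncard_add_numBipComps_le n T hTa
    omega
  obtain ⟨B, hB, hTB⟩ := hTi.subset_isBasis_of_subset hTsub (hME ▸ hF)
  obtain ⟨S, hS, hcard, hJE, hJ⟩ := exists_closed_seq B (hB.subset.trans hF)
  have hBE : B ⊆ M.E := hB.indep.subset_ground
  have hlow := mrk_add_length_le hcirc hne S hS B hBE
  set J := B ∪ unionList S with hJdef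
  have hBJ : M.IsBasis B J := isBasis_of_mrk_le hB.indep Set.subset_union_left (hME ▸ hJE) (by omega)
  have hBU := hBJ.isBasis_union hB
  have hFJ : F ⊆ J := by
    intro e he
    by_contra heJ
    induction e using Sym2.ind with
    | _ u v =>
    have huv : u ≠ v := by simpa using hF he
    have hre : (fromEdgeSet J).Reachable u v := by
      have h1 : T.Reachable u v := by
        rw [hTr]
        exact Adj.reachable ((fromEdgeSet_adj F).2 ⟨he, huv⟩)
      refine h1.mono ?_
      rw [← fromEdgeSet_edgeSet T]
      exact fromEdgeSet_mono (hTB.trans Set.subset_union_left)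
    obtain ⟨hlt, hv⟩ := numBipComps_lt hJ huv heJ hre
    have hins : insert s(u, v) J ⊆ (⊤ : SimpleGraph (Fin n)).edgeSet :=
      Set.insert_subset (hF he) hJE
    have r1 := hMr J hJE
    have r2 := hMr _ hins
    rw [hv] at r2
    have r3 : mrk M (insert s(u, v) J) ≤ mrk M (J ∪ F) :=
      mrk_mono M (Set.insert_subset (Or.inr he) Set.subset_union_left)
    rw [mrk_eq_of_isBasis' hBU.isBasis'] at r3
    rw [mrk_eq_of_isBasis' hBJ.isBasis'] at r1
    omega
  refine ⟨S, hS, ?_⟩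
  have h1 : (F ∪ unionList S).ncard ≤ J.ncard :=
    Set.ncard_le_ncard (Set.union_subset hFJ Set.subset_union_right) (Set.toFinite _)
  rw [mrk_eq_of_isBasis' hB.isBasis']
  unfold valSeq
  omega

theorem mrk_le_valSeq {n : ℕ} {N : Matroid (Sym2 (Fin n))}
    (hN : IsXMatroid (⊤ : SimpleGraph (Fin n)).edgeSet (cycleCopies n 4) N)
    (F : Set (Sym2 (Fin n))) (hF : F ⊆ (⊤ : SimpleGraph (Fin n)).edgeSet)
    (S : List (Set (Sym2 (Fin n)))) (hS : ProperSeq (cycleCopies n 4) S) :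
    (mrk N F : ℤ) ≤ valSeq F S := by
  have h1 := mrk_add_length_le hN.2 (fun C hC => (exists_of_mem_cycleCopies_four hC).1) S hS F
    (hN.1 ▸ hF)
  have h2 := mrk_mono N (Set.subset_union_left : F ⊆ F ∪ unionList S)
  unfold valSeq
  omega

end Aux

theorem evenCycleMatroid_unique_maximal_C4 (n : ℕ) (M : Matroid (Sym2 (Fin n)))
    (hME : M.E = (⊤ : SimpleGraph (Fin n)).edgeSet)
    (hMr : ∀ F ⊆ (⊤ : SimpleGraph (Fin n)).edgeSet,
      (mrk M F : ℤ) = (verts F).ncard - numBipComps n F) :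
    IsXMatroid (⊤ : SimpleGraph (Fin n)).edgeSet (cycleCopies n 4) M ∧
    (∀ N : Matroid (Sym2 (Fin n)),
      IsXMatroid (⊤ : SimpleGraph (Fin n)).edgeSet (cycleCopies n 4) N → WeakLE N M) ∧
    ∀ F ⊆ (⊤ : SimpleGraph (Fin n)).edgeSet, (mrk M F : ℤ) = valX (cycleCopies n 4) F := by
  have hM : IsXMatroid (⊤ : SimpleGraph (Fin n)).edgeSet (cycleCopies n 4) M :=
    ⟨hME, fun C hC => isCircuit'_four hME hMr hC⟩
  refine ⟨hM, ?_, ?_⟩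
  · intro N hN I hI
    have hIE : I ⊆ (⊤ : SimpleGraph (Fin n)).edgeSet := hN.1 ▸ hI.subset_ground
    obtain ⟨S, hS, hle⟩ := exists_seq_le_mrk hME hMr I hIE
    have h1 := mrk_le_valSeq hN I hIE S hS
    rw [mrk_of_indep hI] at h1
    apply indep_of_le_mrk
    omega
  · intro F hF
    obtain ⟨S, hS, hle⟩ := exists_seq_le_mrk hME hMr F hF
    have hlow : ∀ v ∈ {v : ℤ | ∃ S, ProperSeq (cycleCopies n 4) S ∧ v = valSeq F S},
        (mrk M F : ℤ) ≤ v := by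
      rintro _ ⟨S', hS', rfl⟩
      exact mrk_le_valSeq hM F hF S' hS'
    unfold valX
    apply le_antisymm
    · exact le_csInf ⟨_, S, hS, rfl⟩ hlow
    · exact (csInf_le ⟨_, hlow⟩ ⟨S, hS, rfl⟩).trans hle
end
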